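/- arXiv:1606.08610 — 2 statements merged into one kernel-verified Lean document; each statement's English description precedes it below -/
import Mathlib

section
/- Let n ≥ 2, s ∈ (0,1), λ ≥ 1, K ∈ 𝐊(n,s,λ,0), σ ∈ (−1,1), and let Ω ⊆ ℝⁿ be an open set with P(Ω) < ∞. If E_j ⊆ Ω are measurable sets and E_j → E in L¹(Ω) (that is, |E_j Δ E| → 0, with E ⊆ Ω measurable), then liminf_{j→∞} 𝓔(E_j) ≥ 𝓔(E). -/
open MeasureTheory Filter Metric
open scoped ENNReal NNReal symmDiff Topology

/-- Nonlocal interaction energy `I(E,F) = ∫_E ∫_F K(x-y) dy dx` (with values in `ℝ≥0∞`). -/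
noncomputable def inter {n : ℕ} (K : EuclideanSpace ℝ (Fin n) → ℝ)
    (E F : Set (EuclideanSpace ℝ (Fin n))) : ℝ≥0∞ :=
  ∫⁻ x in E, ∫⁻ y in F, ENNReal.ofReal (K (x - y))

/-- Nonlocal capillarity energy `𝓔(E) = I(E, Ω∖E) + σ I(E, Ωᶜ)`, with values in `EReal`. -/
noncomputable def capEnergy {n : ℕ} (K : EuclideanSpace ℝ (Fin n) → ℝ)
    (Ω : Set (EuclideanSpace ℝ (Fin n))) (σ : ℝ)
    (E : Set (EuclideanSpace ℝ (Fin n))) : EReal :=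
  (inter K E (Ω \ E) : EReal) + ((σ * (inter K E Ωᶜ).toReal : ℝ) : EReal)

/-- A form of Fatou's lemma in which both the domains and the integrands vary. -/
lemma setLIntegral_le_liminf_setLIntegral {α : Type*} [MeasurableSpace α] {μ : Measure α}
    {A : ℕ → Set α} {A₀ : Set α} {f : ℕ → α → ℝ≥0∞} {f₀ : α → ℝ≥0∞}
    (hA : ∀ j, MeasurableSet (A j)) (hA₀ : MeasurableSet A₀) (hf : ∀ j, Measurable (f j))
    (hmem : ∀ᵐ x ∂μ, x ∈ A₀ → ∀ᶠ j in atTop, x ∈ A j)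
    (hle : ∀ x, f₀ x ≤ liminf (fun j => f j x) atTop) :
    ∫⁻ x in A₀, f₀ x ∂μ ≤ liminf (fun j => ∫⁻ x in A j, f j x ∂μ) atTop := by
  simp_rw [← lintegral_indicator (hA _), ← lintegral_indicator hA₀]
  refine le_trans (lintegral_mono_ae ?_)
    (lintegral_liminf_le fun j => (hf j).indicator (hA j))
  filter_upwards [hmem] with x hx
  by_cases hx₀ : x ∈ A₀
  · rw [Set.indicator_of_mem hx₀]
    refine (hle x).trans (le_of_eq (liminf_congr ?_))
    filter_upwards [hx hx₀] with j hj
    rw [Set.indicator_of_mem hj]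
  · rw [Set.indicator_of_notMem hx₀]
    exact zero_le

/-- If `E j → E₀` in measure, then along a subsequence almost every point belongs to `E j`
eventually if and only if it belongs to `E₀`. -/
lemma exists_subseq_ae_eventually_mem_iff {α : Type*} [MeasurableSpace α] {μ : Measure α}
    {E : ℕ → Set α} {E₀ : Set α}
    (h : Tendsto (fun j => μ (E j ∆ E₀)) atTop (𝓝 0)) :
    ∃ φ : ℕ → ℕ, StrictMono φ ∧ ∀ᵐ x ∂μ, ∀ᶠ j in atTop, (x ∈ E (φ j) ↔ x ∈ E₀) := by
  obtain ⟨φ, hφ, hφ'⟩ := extraction_forall_of_eventually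
    (P := fun k j => μ (E j ∆ E₀) < (2⁻¹ : ℝ≥0∞) ^ k)
    (fun k => h.eventually_lt_const (ENNReal.pow_pos (by simp) k))
  refine ⟨φ, hφ, ?_⟩
  have hsum : ∑' k, μ (E (φ k) ∆ E₀) ≠ ∞ := by
    refine ne_top_of_le_ne_top ?_ (ENNReal.tsum_le_tsum fun k => (hφ' k).le)
    rw [ENNReal.tsum_geometric]
    simp
  filter_upwards [ae_eventually_notMem hsum] with x hx
  filter_upwards [hx] with j hj
  rw [Set.mem_symmDiff] at hj
  tauto

/-- Set integrals of a fixed integrable function are continuous in the domain. -/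
lemma tendsto_setLIntegral_of_tendsto_symmDiff {α : Type*} [MeasurableSpace α] {μ : Measure α}
    {Ω : Set α} {E : ℕ → Set α} {E₀ : Set α} {f : α → ℝ≥0∞} (hf : ∫⁻ x in Ω, f x ∂μ ≠ ∞)
    (hE : ∀ j, E j ⊆ Ω) (hE₀ : E₀ ⊆ Ω)
    (h : Tendsto (fun j => μ (E j ∆ E₀)) atTop (𝓝 0)) :
    Tendsto (fun j => ∫⁻ x in E j, f x ∂μ) atTop (𝓝 (∫⁻ x in E₀, f x ∂μ)) := by
  have hsub : ∀ j, E j ∆ E₀ ⊆ Ω := fun j =>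
    Set.symmDiff_subset_union.trans (Set.union_subset (hE j) hE₀)
  have hd : Tendsto (fun j => ∫⁻ x in E j ∆ E₀, f x ∂μ) atTop (𝓝 0) := by
    have hr : Tendsto ((μ.restrict Ω) ∘ fun j => E j ∆ E₀) atTop (𝓝 0) :=
      tendsto_of_tendsto_of_tendsto_of_le_of_le tendsto_const_nhds h (fun _ => zero_le)
        fun j => Measure.restrict_apply_le _ _
    refine (tendsto_setLIntegral_zero hf hr).congr fun j => ?_
    rw [Measure.restrict_restrict_of_subset (hsub j)]
  have hfin : ∫⁻ x in E₀, f x ∂μ ≠ ∞ := ne_top_of_le_ne_top hf (lintegral_mono_set hE₀)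
  refine tendsto_of_tendsto_of_tendsto_of_le_of_le
    (g := fun j => ∫⁻ x in E₀, f x ∂μ - ∫⁻ x in E j ∆ E₀, f x ∂μ)
    (h := fun j => ∫⁻ x in E₀, f x ∂μ + ∫⁻ x in E j ∆ E₀, f x ∂μ) ?_ ?_ ?_ ?_
  · simpa using ENNReal.Tendsto.sub tendsto_const_nhds hd (Or.inl hfin)
  · simpa using tendsto_const_nhds.add hd
  · intro j
    refine tsub_le_iff_right.2 ((lintegral_mono_set ?_).trans (lintegral_union_le _ _ _))
    intro x hx
    by_cases hxj : x ∈ E j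
    · exact Or.inl hxj
    · exact Or.inr (Or.inr ⟨hx, hxj⟩)
  · intro j
    refine (lintegral_mono_set ?_).trans (lintegral_union_le _ _ _)
    intro x hx
    by_cases hx₀ : x ∈ E₀
    · exact Or.inl hx₀
    · exact Or.inr (Or.inl ⟨hx, hx₀⟩)

/-- Lower semicontinuity of the interaction of a set with its complement in `Ω`. -/
lemma inter_diff_le_liminf {n : ℕ} {K : EuclideanSpace ℝ (Fin n) → ℝ} (hK : Measurable K)
    {Ω : Set (EuclideanSpace ℝ (Fin n))} (hΩ : MeasurableSet Ω)
    {E : ℕ → Set (EuclideanSpace ℝ (Fin n))} (hE : ∀ j, MeasurableSet (E j))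
    {E₀ : Set (EuclideanSpace ℝ (Fin n))} (hE₀ : MeasurableSet E₀)
    (h : Tendsto (fun j => volume (E j ∆ E₀)) atTop (𝓝 0)) :
    inter K E₀ (Ω \ E₀) ≤ liminf (fun j => inter K (E j) (Ω \ E j)) atTop := by
  by_contra! hlt
  obtain ⟨c, hc, hc'⟩ := exists_between hlt
  obtain ⟨ψ, hψ, hψc⟩ := extraction_of_frequently_atTop
    (frequently_lt_of_liminf_lt (by isBoundedDefault) hc)
  obtain ⟨φ, hφ, hφE⟩ := exists_subseq_ae_eventually_mem_iff (h.comp hψ.tendsto_atTop)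
  have hmeas : Measurable fun p : EuclideanSpace ℝ (Fin n) × EuclideanSpace ℝ (Fin n) =>
      ENNReal.ofReal (K (p.1 - p.2)) := (hK.comp measurable_sub).ennreal_ofReal
  have hle : inter K E₀ (Ω \ E₀) ≤
      liminf (fun j => inter K (E (ψ (φ j))) (Ω \ E (ψ (φ j)))) atTop := by
    refine setLIntegral_le_liminf_setLIntegral (fun j => hE _) hE₀
      (fun j => hmeas.lintegral_prod_right') ?_ fun x => ?_
    · filter_upwards [hφE] with x hx hx₀
      filter_upwards [hx] with j hj using hj.2 hx₀
    · refine setLIntegral_le_liminf_setLIntegral (fun j => hΩ.diff (hE _)) (hΩ.diff hE₀)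
        (fun j => hmeas.comp measurable_prodMk_left) ?_ fun y => by simp
      filter_upwards [hφE] with y hy hy₀
      filter_upwards [hy] with j hj using ⟨hy₀.1, fun h' => hy₀.2 (hj.1 h')⟩
  refine (hle.trans ?_).not_gt hc'
  exact (liminf_le_liminf (Eventually.of_forall fun j => (hψc (φ j)).le)).trans (by simp)

/-- Lower semicontinuity of the nonlocal capillarity energy. -/
theorem stmt1 (n : ℕ) (hn : 2 ≤ n) (s lam : ℝ) (hs : s ∈ Set.Ioo (0 : ℝ) 1) (hlam : 1 ≤ lam)
    (K : EuclideanSpace ℝ (Fin n) → ℝ) (hKmeas : Measurable K)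
    (hKeven : ∀ ζ, K (-ζ) = K ζ) (hKnonneg : ∀ ζ, 0 ≤ K ζ)
    (hKup : ∀ ζ : EuclideanSpace ℝ (Fin n), ζ ≠ 0 → K ζ ≤ lam / ‖ζ‖ ^ ((n : ℝ) + s))
    (σ : ℝ) (hσ : σ ∈ Set.Ioo (-1 : ℝ) 1)
    (Ω : Set (EuclideanSpace ℝ (Fin n))) (hΩo : IsOpen Ω)
    (hP : inter K Ω Ωᶜ ≠ ⊤)
    (E : ℕ → Set (EuclideanSpace ℝ (Fin n)))
    (hEmeas : ∀ j, MeasurableSet (E j)) (hEsub : ∀ j, E j ⊆ Ω)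
    (E₀ : Set (EuclideanSpace ℝ (Fin n))) (hE₀meas : MeasurableSet E₀) (hE₀sub : E₀ ⊆ Ω)
    (hconv : Tendsto (fun j => volume (E j ∆ E₀)) atTop (nhds 0)) :
    capEnergy K Ω σ E₀ ≤ Filter.liminf (fun j => capEnergy K Ω σ (E j)) atTop := by
  have hlsc : ((inter K E₀ (Ω \ E₀) : ℝ≥0∞) : EReal) ≤
      liminf (fun j => ((inter K (E j) (Ω \ E j) : ℝ≥0∞) : EReal)) atTop := by
    have hmono : Monotone ((↑) : ℝ≥0∞ → EReal) := fun _ _ h =>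
      EReal.coe_ennreal_le_coe_ennreal_iff.2 h
    have hmap := hmono.map_liminf_of_continuousAt (F := atTop)
      (fun j => inter K (E j) (Ω \ E j)) continuous_coe_ennreal_ereal.continuousAt
    exact (hmono (inter_diff_le_liminf hKmeas hΩo.measurableSet hEmeas hE₀meas hconv)).trans
      hmap.le
  have hfin : inter K E₀ Ωᶜ ≠ ⊤ := ne_top_of_le_ne_top hP (lintegral_mono_set hE₀sub)
  have hlim : Tendsto (fun j => ((σ * (inter K (E j) Ωᶜ).toReal : ℝ) : EReal)) atTop
      (𝓝 ((σ * (inter K E₀ Ωᶜ).toReal : ℝ) : EReal)) :=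
    (continuous_coe_real_ereal.tendsto _).comp
      (((ENNReal.tendsto_toReal hfin).comp
        (tendsto_setLIntegral_of_tendsto_symmDiff hP hEsub hE₀sub
          hconv)).const_mul σ)
  unfold capEnergy
  calc _ ≤ liminf (fun j => ((inter K (E j) (Ω \ E j) : ℝ≥0∞) : EReal)) atTop +
        liminf (fun j => ((σ * (inter K (E j) Ωᶜ).toReal : ℝ) : EReal)) atTop := by
        rw [hlim.liminf_eq]
        exact add_le_add_left hlsc _
    _ ≤ _ := EReal.le_liminf_add
end

section
/- Let n ≥ 2, s ∈ (0,1), λ ≥ 1, σ ∈ (−1,1), Λ ≥ 0, r₀ ∈ (0,∞], K ∈ 𝐊(n,s,λ), and let Ω, A ⊆ ℝⁿ be open sets with I(Ω∩A, ℝⁿ∖Ω) < ∞. Then a measurable set E ⊆ Ω is a (Λ,r₀,σ,K)-minimizer in (A,Ω) if and only if Ω∖E is a (Λ,r₀,−σ,K)-minimizer in (A,Ω). -/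
open MeasureTheory Filter Metric
open scoped ENNReal NNReal symmDiff Topology

/-- The localized capillarity energy of `E` relative to `(A, Ω)`. -/
noncomputable def minSum {n : ℕ} (K : EuclideanSpace ℝ (Fin n) → ℝ)
    (A Ω E : Set (EuclideanSpace ℝ (Fin n))) (σ : ℝ) : EReal :=
  (inter K (E ∩ A) (Ω \ E) : EReal) + (inter K (E \ A) ((Ω \ E) ∩ A) : EReal)
    + ((σ * (inter K (E ∩ A) Ωᶜ).toReal : ℝ) : EReal)

/-- `E` is a `(Λ, r₀, σ, K)`-minimizer in `(A, Ω)` (Definition 1.5). -/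
def IsAlmostMin {n : ℕ} (K : EuclideanSpace ℝ (Fin n) → ℝ)
    (A Ω : Set (EuclideanSpace ℝ (Fin n))) (Λ : ℝ) (r₀ : ℝ≥0∞) (σ : ℝ)
    (E : Set (EuclideanSpace ℝ (Fin n))) : Prop :=
  MeasurableSet E ∧ E ⊆ Ω ∧
    ∀ F : Set (EuclideanSpace ℝ (Fin n)), MeasurableSet F → F ⊆ Ω →
      EMetric.diam (F ∆ E) < 2 * r₀ → F \ A = E \ A →
      minSum K A Ω E σ ≤ minSum K A Ω F σ + ((Λ * (volume (E ∆ F)).toReal : ℝ) : EReal)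

theorem measurable_inter_kernel {n : ℕ} {K : EuclideanSpace ℝ (Fin n) → ℝ} (hK : Measurable K) :
    Measurable fun p : EuclideanSpace ℝ (Fin n) × EuclideanSpace ℝ (Fin n) =>
      ENNReal.ofReal (K (p.1 - p.2)) :=
  (hK.comp (measurable_fst.sub measurable_snd)).ennreal_ofReal

theorem inter_comm {n : ℕ} {K : EuclideanSpace ℝ (Fin n) → ℝ} (hK : Measurable K)
    (heven : ∀ ζ, K (-ζ) = K ζ) (E F : Set (EuclideanSpace ℝ (Fin n))) :
    inter K E F = inter K F E := by
  unfold inter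
  rw [lintegral_lintegral_swap (measurable_inter_kernel hK).aemeasurable]
  refine lintegral_congr fun y => lintegral_congr fun x => ?_
  rw [← heven (x - y), neg_sub]

theorem inter_union_left {n : ℕ} (K : EuclideanSpace ℝ (Fin n) → ℝ)
    {E E' : Set (EuclideanSpace ℝ (Fin n))} (F : Set (EuclideanSpace ℝ (Fin n)))
    (hE' : MeasurableSet E') (hd : Disjoint E E') :
    inter K (E ∪ E') F = inter K E F + inter K E' F :=
  lintegral_union hE' hd

theorem inter_union_right {n : ℕ} {K : EuclideanSpace ℝ (Fin n) → ℝ} (hK : Measurable K)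
    (heven : ∀ ζ, K (-ζ) = K ζ) (E : Set (EuclideanSpace ℝ (Fin n)))
    {F F' : Set (EuclideanSpace ℝ (Fin n))} (hF' : MeasurableSet F') (hd : Disjoint F F') :
    inter K E (F ∪ F') = inter K E F + inter K E F' := by
  rw [inter_comm hK heven, inter_union_left K E hF' hd, inter_comm hK heven F,
    inter_comm hK heven F']

/-- The interior part of the localized energy is unchanged under complementation in `Ω`. -/
theorem inter_add_inter_compl {n : ℕ} {K : EuclideanSpace ℝ (Fin n) → ℝ} (hK : Measurable K)
    (heven : ∀ ζ, K (-ζ) = K ζ) {A E G : Set (EuclideanSpace ℝ (Fin n))}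
    (hA : MeasurableSet A) (hE : MeasurableSet E) (hG : MeasurableSet G) :
    inter K (G ∩ A) E + inter K (G \ A) (E ∩ A) =
      inter K (E ∩ A) G + inter K (E \ A) (G ∩ A) := by
  have split {X Y : Set (EuclideanSpace ℝ (Fin n))} (hY : MeasurableSet Y) :
      inter K X Y = inter K X (Y ∩ A) + inter K X (Y \ A) := by
    rw [← inter_union_right hK heven X (hY.diff hA) Set.disjoint_sdiff_inter.symm,
      Set.inter_union_sdiff]
  rw [split hE, split hG, inter_comm hK heven (G ∩ A) (E ∩ A),
    inter_comm hK heven (G ∩ A) (E \ A), inter_comm hK heven (G \ A) (E ∩ A)]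
  exact add_right_comm _ _ _

theorem minSum_diff_neg {n : ℕ} {K : EuclideanSpace ℝ (Fin n) → ℝ} (hK : Measurable K)
    (heven : ∀ ζ, K (-ζ) = K ζ) {A Ω E : Set (EuclideanSpace ℝ (Fin n))}
    (hA : MeasurableSet A) (hΩ : MeasurableSet Ω) (hint : inter K (Ω ∩ A) Ωᶜ ≠ ⊤)
    (hE : MeasurableSet E) (hEΩ : E ⊆ Ω) (σ : ℝ) :
    minSum K A Ω (Ω \ E) (-σ) =
      minSum K A Ω E σ + ((-(σ * (inter K (Ω ∩ A) Ωᶜ).toReal) : ℝ) : EReal) := by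
  have hsum : inter K (Ω ∩ A) Ωᶜ = inter K (E ∩ A) Ωᶜ + inter K ((Ω \ E) ∩ A) Ωᶜ := by
    rw [← inter_union_left K Ωᶜ ((hΩ.diff hE).inter hA)
      (Set.disjoint_sdiff_right.mono Set.inter_subset_left Set.inter_subset_left),
      ← Set.union_inter_distrib_right, Set.union_sdiff_cancel hEΩ]
  have hfin := hint
  rw [hsum, ENNReal.add_ne_top] at hfin
  unfold minSum
  rw [Set.sdiff_sdiff_cancel_left hEΩ, ← EReal.coe_ennreal_add, ← EReal.coe_ennreal_add,
    inter_add_inter_compl hK heven hA hE (hΩ.diff hE), hsum,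
    ENNReal.toReal_add hfin.1 hfin.2, add_assoc, ← EReal.coe_add]
  congr 2
  ring

theorem IsAlmostMin.diff_neg {n : ℕ} {K : EuclideanSpace ℝ (Fin n) → ℝ} (hK : Measurable K)
    (heven : ∀ ζ, K (-ζ) = K ζ) {A Ω E : Set (EuclideanSpace ℝ (Fin n))}
    (hA : MeasurableSet A) (hΩ : MeasurableSet Ω) (hint : inter K (Ω ∩ A) Ωᶜ ≠ ⊤)
    {Λ σ : ℝ} {r₀ : ℝ≥0∞} (h : IsAlmostMin K A Ω Λ r₀ σ E) :
    IsAlmostMin K A Ω Λ r₀ (-σ) (Ω \ E) := by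
  obtain ⟨hE, hEΩ, hmin⟩ := h
  refine ⟨hΩ.diff hE, Set.sdiff_subset, fun F hF hFΩ hdiam hFA => ?_⟩
  have hsymm : (Ω \ F) ∆ E = F ∆ (Ω \ E) := by
    ext x
    have := @hEΩ x
    have := @hFΩ x
    simp only [Set.mem_symmDiff, Set.mem_sdiff]
    tauto
  have houter : (Ω \ F) \ A = E \ A := by
    ext x
    have := @hEΩ x
    have hx := Set.ext_iff.mp hFA x
    simp only [Set.mem_sdiff] at hx ⊢
    tauto
  have key := hmin (Ω \ F) (hΩ.diff hF) Set.sdiff_subset (hsymm ▸ hdiam) houter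
  rw [symmDiff_comm, hsymm, symmDiff_comm] at key
  have hF' := minSum_diff_neg hK heven hA hΩ hint (hΩ.diff hF) Set.sdiff_subset σ
  rw [Set.sdiff_sdiff_cancel_left hFΩ] at hF'
  rw [minSum_diff_neg hK heven hA hΩ hint hE hEΩ, hF', add_right_comm]
  gcongr


/-- Remark 5.2: `E` is a `(Λ,r₀,σ,K)`-minimizer in `(A,Ω)` if and only if
`Ω∖E` is a `(Λ,r₀,−σ,K)`-minimizer in `(A,Ω)`. -/
theorem stmt16 (n : ℕ) (hn : 2 ≤ n) (s lam Λ σ : ℝ) (hs : s ∈ Set.Ioo (0 : ℝ) 1)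
    (hlam : 1 ≤ lam) (hΛ : 0 ≤ Λ) (hσ : σ ∈ Set.Ioo (-1 : ℝ) 1)
    (r₀ : ℝ≥0∞) (hr₀ : 0 < r₀)
    (K : EuclideanSpace ℝ (Fin n) → ℝ) (hKmeas : Measurable K)
    (hKeven : ∀ ζ, K (-ζ) = K ζ) (hKnonneg : ∀ ζ, 0 ≤ K ζ)
    (hKup : ∀ ζ : EuclideanSpace ℝ (Fin n), ζ ≠ 0 → K ζ ≤ lam / ‖ζ‖ ^ ((n : ℝ) + s))
    (A Ω : Set (EuclideanSpace ℝ (Fin n))) (hA : IsOpen A) (hΩ : IsOpen Ω)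
    (hint : inter K (Ω ∩ A) Ωᶜ ≠ ⊤)
    (E : Set (EuclideanSpace ℝ (Fin n))) (hEmeas : MeasurableSet E) (hEΩ : E ⊆ Ω) :
    IsAlmostMin K A Ω Λ r₀ σ E ↔ IsAlmostMin K A Ω Λ r₀ (-σ) (Ω \ E) := by
  refine ⟨IsAlmostMin.diff_neg hKmeas hKeven hA.measurableSet hΩ.measurableSet hint, fun h => ?_⟩
  have h' := h.diff_neg hKmeas hKeven hA.measurableSet hΩ.measurableSet hint
  rwa [neg_neg, Set.sdiff_sdiff_cancel_left hEΩ] at h'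
end
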